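/- Let α > 0, I = [a,T], and let Ψ ∈ C¹(I) be increasing with Ψ'(t) > 0 for all t ∈ I. Let u, v : I → ℝ be integrable and nonnegative with v nondecreasing, and let g : I → ℝ be continuous, nonnegative and nondecreasing. If u(t) ≤ v(t) + g(t) ∫_a^t Ψ'(s)(Ψ(t) − Ψ(s))^{α−1} u(s) ds for all t ∈ I, then u(t) ≤ v(t) · E_α( g(t) Γ(α) (Ψ(t) − Ψ(a))^α ) for all t ∈ I. -/

import Mathlib

open MeasureTheory

/-- The Mittag-Leffler function `E_α(z) = ∑_{k=0}^∞ z^k / Γ(αk + 1)`. -/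
noncomputable def mittagLeffler (α z : ℝ) : ℝ :=
  ∑' k : ℕ, z ^ k / Real.Gamma (α * k + 1)

open Set Filter Topology ENNReal

/-- Superexponential growth of the Gamma function. -/
lemma rpow_mul_exp_neg_le_Gamma {x R : ℝ} (hx : 0 ≤ x) (hR : 0 < R) :
    R ^ x * Real.exp (-R) ≤ Real.Gamma (x + 1) := by
  have hintegral := Real.GammaIntegral_convergent (s := x + 1) (by positivity)
  have hnonneg : ∀ y ∈ Ioi (0 : ℝ), 0 ≤ Real.exp (-y) * y ^ (x + 1 - 1) := fun y hy =>
    mul_nonneg (Real.exp_pos _).le (Real.rpow_nonneg (le_of_lt hy) _)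
  rw [Real.Gamma_eq_integral (by positivity), ← integral_exp_neg_Ioi R, ← integral_const_mul]
  calc ∫ y in Ioi R, R ^ x * Real.exp (-y)
      ≤ ∫ y in Ioi R, Real.exp (-y) * y ^ (x + 1 - 1) := by
        refine setIntegral_mono_on ((integrableOn_exp_neg_Ioi R).const_mul _)
          (hintegral.mono_set (Ioi_subset_Ioi hR.le)) measurableSet_Ioi fun y hy => ?_
        rw [mul_comm, add_sub_cancel_right]
        have : R ≤ y := le_of_lt hy
        gcongr
    _ ≤ ∫ y in Ioi 0, Real.exp (-y) * y ^ (x + 1 - 1) :=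
        setIntegral_mono_set hintegral (ae_restrict_of_forall_mem measurableSet_Ioi hnonneg)
          (Ioi_subset_Ioi hR.le).eventuallyLE

lemma summable_pow_div_Gamma {α q z : ℝ} (hα : 0 < α) (hz : 0 ≤ z) :
    Summable fun n : ℕ => z ^ n / Real.Gamma (α * n + q) := by
  set R : ℝ := (2 * (z + 1)) ^ α⁻¹
  have hR : 0 < R := by positivity
  have hRα : R ^ α = 2 * (z + 1) := Real.rpow_inv_rpow (by positivity) hα.ne'
  have hgeom : Summable fun n : ℕ =>
      (Real.exp R * R ^ (1 - q)) * (z / (2 * (z + 1))) ^ n :=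
    (summable_geometric_of_lt_one (by positivity)
      ((div_lt_one (by positivity)).2 (by linarith))).mul_left _
  refine hgeom.of_norm_bounded_eventually_nat ?_
  have hlim : Tendsto (fun n : ℕ => α * (n : ℝ)) atTop atTop :=
    tendsto_natCast_atTop_atTop.const_mul_atTop hα
  filter_upwards [hlim.eventually_ge_atTop (1 - q)] with n hn
  have hΓ := rpow_mul_exp_neg_le_Gamma (x := α * n + q - 1) (by linarith) hR
  rw [sub_add_cancel] at hΓ
  have hpos : 0 < R ^ (α * n + q - 1) * Real.exp (-R) := by positivity
  rw [Real.norm_of_nonneg (div_nonneg (by positivity) (hpos.le.trans hΓ))]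
  have hpow : R ^ (α * n + q - 1) = (2 * (z + 1)) ^ n / R ^ (1 - q) := by
    rw [show α * n + q - 1 = α * n - (1 - q) by ring, Real.rpow_sub hR, Real.rpow_mul hR.le, hRα,
      Real.rpow_natCast]
  calc z ^ n / Real.Gamma (α * n + q) ≤ z ^ n / (R ^ (α * n + q - 1) * Real.exp (-R)) := by
        gcongr
    _ = _ := by
        rw [hpow, Real.exp_neg, div_pow]
        field_simp

/-- The normalized kernel of the Ψ-fractional integral of order `β`. -/
noncomputable def psiKernel (Ψ Ψ' : ℝ → ℝ) (β t s : ℝ) : ℝ≥0∞ :=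
  ENNReal.ofReal (Ψ' s * (Ψ t - Ψ s) ^ (β - 1) / Real.Gamma β)

/-- The Ψ-fractional integral of order `β` with base point `a` of an extended nonnegative
function. -/
noncomputable def psiIntegral (Ψ Ψ' : ℝ → ℝ) (a β : ℝ) (f : ℝ → ℝ≥0∞) (t : ℝ) : ℝ≥0∞ :=
  ∫⁻ s in Ioo a t, psiKernel Ψ Ψ' β t s * f s

section

variable {Ψ Ψ' : ℝ → ℝ}

lemma lintegral_psi_beta {r t p q : ℝ} (hrt : r < t)
    (hderiv : ∀ s ∈ Icc r t, HasDerivAt Ψ (Ψ' s) s) (hpos : ∀ s ∈ Icc r t, 0 < Ψ' s)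
    (hmono : StrictMonoOn Ψ (Icc r t)) (hp : 0 < p) (hq : 0 < q) :
    ∫⁻ s in Ioo r t, psiKernel Ψ Ψ' p t s * ENNReal.ofReal ((Ψ s - Ψ r) ^ (q - 1) / Real.Gamma q)
      = ENNReal.ofReal ((Ψ t - Ψ r) ^ (p + q - 1) / Real.Gamma (p + q)) := by
  have hr : r ∈ Icc r t := left_mem_Icc.2 hrt.le
  have ht : t ∈ Icc r t := right_mem_Icc.2 hrt.le
  set L := Ψ t - Ψ r with hL
  have hLpos : 0 < L := sub_pos.2 (hmono hr ht hrt)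
  have hsub : Ioo r t ⊆ Icc r t := Ioo_subset_Icc_self
  set φ : ℝ → ℝ := fun s => (Ψ s - Ψ r) / L with hφ
  have hφmono : StrictMonoOn φ (Icc r t) := fun x hx y hy hxy => by
    have := hmono hx hy hxy
    simp only [hφ]
    gcongr
  have hφr : φ r = 0 := by simp [hφ]
  have hφt : φ t = 1 := div_self hLpos.ne'
  have hcont : ContinuousOn φ (Icc r t) := fun s hs =>
    (((hderiv s hs).continuousAt.sub continuousAt_const).div_const L).continuousWithinAt
  have himage : φ '' Ioo r t = Ioo 0 1 := by
    apply Subset.antisymm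
    · rintro _ ⟨s, hs, rfl⟩
      exact ⟨hφr ▸ hφmono hr (hsub hs) hs.1, hφt ▸ hφmono (hsub hs) ht hs.2⟩
    · have := intermediate_value_Ioo hrt.le hcont
      rwa [hφr, hφt] at this
  have hbeta := ProbabilityTheory.lintegral_betaPDF_eq_one hq hp
  rw [ProbabilityTheory.lintegral_betaPDF, ← himage,
    lintegral_image_eq_lintegral_abs_deriv_mul measurableSet_Ioo
      (fun s hs => (((hderiv s (hsub hs)).sub_const (Ψ r)).div_const L).hasDerivWithinAt)
      (hφmono.mono hsub).injOn] at hbeta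
  have hΓp := Real.Gamma_pos_of_pos hp
  have hΓq := Real.Gamma_pos_of_pos hq
  have hΓpq := Real.Gamma_pos_of_pos (add_pos hp hq)
  rw [← mul_one (ENNReal.ofReal (L ^ (p + q - 1) / Real.Gamma (p + q))), ← hbeta,
    ← lintegral_const_mul' _ _ ofReal_ne_top]
  refine setLIntegral_congr_fun measurableSet_Ioo fun s hs => ?_
  have h1 : 0 < Ψ s - Ψ r := sub_pos.2 (hmono hr (hsub hs) hs.1)
  have h2 : 0 < Ψ t - Ψ s := sub_pos.2 (hmono (hsub hs) ht hs.2)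
  have h3 := hpos s (hsub hs)
  simp only [psiKernel]
  rw [abs_of_pos (by positivity), ← ofReal_mul (by positivity), ← ofReal_mul (by positivity),
    ← ofReal_mul (by positivity)]
  congr 1
  have h4 : 1 - (Ψ s - Ψ r) / L = (Ψ t - Ψ s) / L := by
    field_simp
    rw [hL]; ring
  have h5 : L ^ (p + q - 1) = L ^ (p - 1) * L ^ (q - 1) * L := by
    rw [← Real.rpow_add hLpos, ← Real.rpow_add_one hLpos.ne']
    congr 1; ring
  rw [h4, Real.div_rpow h2.le hLpos.le, Real.div_rpow h1.le hLpos.le, h5, ProbabilityTheory.beta,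
    add_comm q p]
  field_simp

variable {a t : ℝ}

lemma aemeasurable_psiKernel (hderiv : ∀ s ∈ Icc a t, HasDerivAt Ψ (Ψ' s) s)
    (hcont : ContinuousOn Ψ' (Icc a t)) (β x : ℝ) :
    AEMeasurable (psiKernel Ψ Ψ' β x) (volume.restrict (Ioo a t)) := by
  have hΨ : AEMeasurable Ψ (volume.restrict (Ioo a t)) :=
    ContinuousOn.aemeasurable
      (fun s hs => (hderiv s (Ioo_subset_Icc_self hs)).continuousAt.continuousWithinAt)
      measurableSet_Ioo
  have hΨ' : AEMeasurable Ψ' (volume.restrict (Ioo a t)) :=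
    (hcont.mono Ioo_subset_Icc_self).aemeasurable measurableSet_Ioo
  exact ((hΨ'.mul ((hΨ.const_sub _).pow_const _)).div_const _).ennreal_ofReal

lemma psiIntegral_const {β : ℝ} (hat : a < t)
    (hderiv : ∀ s ∈ Icc a t, HasDerivAt Ψ (Ψ' s) s) (hpos : ∀ s ∈ Icc a t, 0 < Ψ' s)
    (hmono : StrictMonoOn Ψ (Icc a t)) (hβ : 0 < β) {V : ℝ≥0∞} (hV : V ≠ ∞) :
    psiIntegral Ψ Ψ' a β (fun _ => V) t
      = V * ENNReal.ofReal ((Ψ t - Ψ a) ^ β / Real.Gamma (β + 1)) := by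
  have h := lintegral_psi_beta hat hderiv hpos hmono hβ one_pos
  simp only [sub_self, Real.rpow_zero, Real.Gamma_one, div_one, ofReal_one, mul_one,
    add_sub_cancel_right] at h
  rw [psiIntegral, lintegral_mul_const' _ _ hV, h, mul_comm]

/-- Semigroup property of the Ψ-fractional integrals. -/
lemma psiIntegral_psiIntegral {p q : ℝ}
    (hderiv : ∀ s ∈ Icc a t, HasDerivAt Ψ (Ψ' s) s) (hcont : ContinuousOn Ψ' (Icc a t))
    (hpos : ∀ s ∈ Icc a t, 0 < Ψ' s) (hmono : StrictMonoOn Ψ (Icc a t))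
    (hp : 0 < p) (hq : 0 < q) {f : ℝ → ℝ≥0∞}
    (hf : AEMeasurable f (volume.restrict (Ioo a t))) :
    psiIntegral Ψ Ψ' a p (psiIntegral Ψ Ψ' a q f) t = psiIntegral Ψ Ψ' a (p + q) f t := by
  set μ := volume.restrict (Ioo a t) with hμ
  have hΨ : AEMeasurable Ψ μ :=
    ContinuousOn.aemeasurable
      (fun s hs => (hderiv s (Ioo_subset_Icc_self hs)).continuousAt.continuousWithinAt)
      measurableSet_Ioo
  have hΨ' : AEMeasurable Ψ' μ :=
    (hcont.mono Ioo_subset_Icc_self).aemeasurable measurableSet_Ioo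
  let F : ℝ → ℝ → ℝ≥0∞ := fun s r =>
    (Iio s).indicator (fun r => psiKernel Ψ Ψ' p t s * (psiKernel Ψ Ψ' q s r * f r)) r
  have hF : AEMeasurable (Function.uncurry F) (μ.prod μ) := by
    have hk : AEMeasurable (fun z : ℝ × ℝ => psiKernel Ψ Ψ' q z.1 z.2) (μ.prod μ) :=
      ((hΨ'.comp_snd.mul ((hΨ.comp_fst.sub hΨ.comp_snd).pow_const _)).div_const _).ennreal_ofReal
    have hg : AEMeasurable (fun z : ℝ × ℝ =>
        psiKernel Ψ Ψ' p t z.1 * (psiKernel Ψ Ψ' q z.1 z.2 * f z.2)) (μ.prod μ) :=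
      (aemeasurable_psiKernel hderiv hcont p t).comp_fst.mul (hk.mul hf.comp_snd)
    exact hg.indicator (measurableSet_lt measurable_snd measurable_fst)
  calc psiIntegral Ψ Ψ' a p (psiIntegral Ψ Ψ' a q f) t = ∫⁻ s, ∫⁻ r, F s r ∂μ ∂μ := by
        refine setLIntegral_congr_fun measurableSet_Ioo fun s hs => ?_
        simp only [F]
        rw [psiIntegral, ← lintegral_const_mul' (psiKernel Ψ Ψ' p t s) _ ofReal_ne_top,
          lintegral_indicator measurableSet_Iio, hμ, Measure.restrict_restrict measurableSet_Iio,
          inter_comm, Ioo_inter_Iio, min_eq_right hs.2.le]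
    _ = ∫⁻ r, ∫⁻ s, F s r ∂μ ∂μ := lintegral_lintegral_swap hF
    _ = psiIntegral Ψ Ψ' a (p + q) f t := by
        refine setLIntegral_congr_fun measurableSet_Ioo fun r hr => ?_
        have hsub : Icc r t ⊆ Icc a t := Icc_subset_Icc_left hr.1.le
        have hΨ'r : 0 < Ψ' r := hpos r (Ioo_subset_Icc_self hr)
        have hb := lintegral_psi_beta hr.2 (fun s hs => hderiv s (hsub hs))
          (fun s hs => hpos s (hsub hs)) (hmono.mono hsub) hp hq
        have hm : AEMeasurable (fun s => psiKernel Ψ Ψ' p t s *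
            ENNReal.ofReal ((Ψ s - Ψ r) ^ (q - 1) / Real.Gamma q))
            (volume.restrict (Ioo r t)) := by
          have hle : volume.restrict (Ioo r t) ≤ μ :=
            Measure.restrict_mono (Ioo_subset_Ioo_left hr.1.le) le_rfl
          exact ((aemeasurable_psiKernel hderiv hcont p t).mono_measure hle).mul
            ((((hΨ.mono_measure hle).sub_const _).pow_const _).div_const _).ennreal_ofReal
        have hFr : ∀ s, F s r = (Ioi r).indicator (fun s => ENNReal.ofReal (Ψ' r) * f r *
            (psiKernel Ψ Ψ' p t s *
              ENNReal.ofReal ((Ψ s - Ψ r) ^ (q - 1) / Real.Gamma q))) s := by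
          intro s
          by_cases h : r < s
          · simp only [F, indicator_of_mem (show r ∈ Iio s from h),
              indicator_of_mem (show s ∈ Ioi r from h)]
            rw [show psiKernel Ψ Ψ' q s r = ENNReal.ofReal (Ψ' r) *
                ENNReal.ofReal ((Ψ s - Ψ r) ^ (q - 1) / Real.Gamma q) by
              rw [psiKernel, mul_div_assoc, ofReal_mul hΨ'r.le]]
            ring
          · simp only [F, indicator_of_notMem (show r ∉ Iio s from h),
              indicator_of_notMem (show s ∉ Ioi r from h)]
        simp only [hFr]
        rw [lintegral_indicator measurableSet_Ioi, hμ, Measure.restrict_restrict measurableSet_Ioi,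
          inter_comm, Ioo_inter_Ioi, max_eq_right hr.1.le, lintegral_const_mul'' _ hm, hb,
          psiKernel, mul_div_assoc, ofReal_mul hΨ'r.le]
        ring

lemma psiIntegral_iterate_bound {α : ℝ} (hat : a < t)
    (hderiv : ∀ s ∈ Icc a t, HasDerivAt Ψ (Ψ' s) s) (hcont : ContinuousOn Ψ' (Icc a t))
    (hpos : ∀ s ∈ Icc a t, 0 < Ψ' s) (hmono : StrictMonoOn Ψ (Icc a t))
    (hα : 0 < α) {f : ℝ → ℝ≥0∞} (hf : AEMeasurable f (volume.restrict (Ioo a t)))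
    {V : ℝ≥0∞} (hV : V ≠ ∞) {c : ℝ} (hc : 0 ≤ c)
    (hle : ∀ s ∈ Ioc a t, f s ≤ V + ENNReal.ofReal c * psiIntegral Ψ Ψ' a α f s) (n : ℕ) :
    f t ≤ V * ∑ k ∈ Finset.range (n + 1),
        ENNReal.ofReal ((c * (Ψ t - Ψ a) ^ α) ^ k / Real.Gamma (α * k + 1))
      + ENNReal.ofReal c ^ (n + 1) * psiIntegral Ψ Ψ' a (α * (n + 1 : ℕ)) f t := by
  have hL : 0 < Ψ t - Ψ a :=
    sub_pos.2 (hmono (left_mem_Icc.2 hat.le) (right_mem_Icc.2 hat.le) hat)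
  induction n with
  | zero => simpa using hle t (right_mem_Ioc.2 hat)
  | succ n ih =>
    have hβ : 0 < α * (n + 1 : ℕ) := by positivity
    set β : ℝ := α * (n + 1 : ℕ) with hβdef
    have hstep : psiIntegral Ψ Ψ' a β f t
        ≤ V * ENNReal.ofReal ((Ψ t - Ψ a) ^ β / Real.Gamma (β + 1))
          + ENNReal.ofReal c * psiIntegral Ψ Ψ' a (β + α) f t := by
      rw [← psiIntegral_const hat hderiv hpos hmono hβ hV,
        ← psiIntegral_psiIntegral hderiv hcont hpos hmono hβ hα hf]
      simp only [psiIntegral]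
      rw [← lintegral_const_mul' _ _ ofReal_ne_top, ← lintegral_add_left'
        ((aemeasurable_psiKernel hderiv hcont β t).mul_const V)]
      refine setLIntegral_mono' measurableSet_Ioo fun s hs => ?_
      calc psiKernel Ψ Ψ' β t s * f s
          ≤ psiKernel Ψ Ψ' β t s * (V + ENNReal.ofReal c * psiIntegral Ψ Ψ' a α f s) := by
            gcongr
            exact hle s (Ioo_subset_Ioc_self hs)
        _ = _ := by rw [psiIntegral]; ring
    have hterm : ENNReal.ofReal c ^ (n + 1) * ENNReal.ofReal ((Ψ t - Ψ a) ^ β / Real.Gamma (β + 1))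
        = ENNReal.ofReal ((c * (Ψ t - Ψ a) ^ α) ^ (n + 1) / Real.Gamma (α * (n + 1 : ℕ) + 1)) := by
      rw [← ofReal_pow hc, ← ofReal_mul (by positivity), mul_pow, hβdef, Real.rpow_mul hL.le,
        Real.rpow_natCast, mul_div_assoc]
    have hexp : β + α = α * (n + 1 + 1 : ℕ) := by rw [hβdef]; push_cast; ring
    calc f t ≤ _ := ih
      _ ≤ V * ∑ k ∈ Finset.range (n + 1),
            ENNReal.ofReal ((c * (Ψ t - Ψ a) ^ α) ^ k / Real.Gamma (α * k + 1))
          + ENNReal.ofReal c ^ (n + 1) *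
            (V * ENNReal.ofReal ((Ψ t - Ψ a) ^ β / Real.Gamma (β + 1))
              + ENNReal.ofReal c * psiIntegral Ψ Ψ' a (β + α) f t) := by gcongr
      _ = _ := by
        rw [Finset.sum_range_succ _ (n + 1), ← hterm, hexp]
        ring

lemma tendsto_pow_mul_psiIntegral {α : ℝ} (hat : a < t)
    (hcont : ContinuousOn Ψ' (Icc a t)) (hpos : ∀ s ∈ Icc a t, 0 < Ψ' s)
    (hmono : StrictMonoOn Ψ (Icc a t)) (hα : 0 < α) {f : ℝ → ℝ≥0∞}
    (hf : ∫⁻ s in Ioo a t, f s ≠ ∞) {c : ℝ} (hc : 0 ≤ c) :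
    Tendsto (fun n : ℕ => ENNReal.ofReal c ^ n * psiIntegral Ψ Ψ' a (α * n) f t) atTop (𝓝 0) := by
  have ha' : a ∈ Icc a t := left_mem_Icc.2 hat.le
  have ht' : t ∈ Icc a t := right_mem_Icc.2 hat.le
  have hL : 0 < Ψ t - Ψ a := sub_pos.2 (hmono ha' ht' hat)
  set L := Ψ t - Ψ a with hLdef
  obtain ⟨C, hC⟩ := isCompact_Icc.exists_bound_of_continuousOn hcont
  have hz : 0 ≤ c * L ^ α := by positivity
  have hlim0 := (summable_pow_div_Gamma (q := 0) hα hz).tendsto_atTop_zero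
  have hlim : Tendsto (fun n : ℕ => ENNReal.ofReal
      (C / L * ((c * L ^ α) ^ n / Real.Gamma (α * n + 0))) * ∫⁻ s in Ioo a t, f s) atTop (𝓝 0) := by
    have h1 := ENNReal.tendsto_ofReal (hlim0.const_mul (C / L))
    rw [mul_zero, ofReal_zero] at h1
    simpa using ENNReal.Tendsto.mul_const h1 (Or.inr hf)
  refine tendsto_of_tendsto_of_tendsto_of_le_of_le' tendsto_const_nhds hlim
    (Eventually.of_forall fun _ => zero_le) ?_
  have hαn : Tendsto (fun n : ℕ => α * (n : ℝ)) atTop atTop :=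
    tendsto_natCast_atTop_atTop.const_mul_atTop hα
  filter_upwards [hαn.eventually_ge_atTop 1] with n hn
  rw [psiIntegral, ← lintegral_const_mul' _ _ (ENNReal.pow_ne_top ofReal_ne_top),
    ← lintegral_const_mul' _ _ ofReal_ne_top]
  refine setLIntegral_mono' measurableSet_Ioo fun s hs => ?_
  have hs' := Ioo_subset_Icc_self hs
  have h1 : 0 < Ψ t - Ψ s := sub_pos.2 (hmono hs' ht' hs.2)
  have h2 : Ψ t - Ψ s ≤ L := by
    have := hmono ha' hs' hs.1
    rw [hLdef]; linarith
  have h3 := hpos s hs'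
  have h4 : Ψ' s ≤ C := (le_abs_self _).trans (hC s hs')
  have hΓ : 0 < Real.Gamma (α * n) := Real.Gamma_pos_of_pos (by linarith)
  rw [← mul_assoc, psiKernel, ← ofReal_pow hc, ← ofReal_mul (by positivity), add_zero]
  refine mul_le_mul' (ofReal_le_ofReal ?_) le_rfl
  calc c ^ n * (Ψ' s * (Ψ t - Ψ s) ^ (α * n - 1) / Real.Gamma (α * n))
      ≤ c ^ n * (C * L ^ (α * n - 1) / Real.Gamma (α * n)) := by
        have : (Ψ t - Ψ s) ^ (α * n - 1) ≤ L ^ (α * n - 1) :=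
          Real.rpow_le_rpow h1.le h2 (by linarith)
        have : 0 ≤ C := h3.le.trans h4
        gcongr
    _ = _ := by
        rw [Real.rpow_sub_one hL.ne', Real.rpow_mul hL.le, Real.rpow_natCast, mul_pow]
        ring

end

lemma one_le_mittagLeffler {α z : ℝ} (hα : 0 < α) (hz : 0 ≤ z) : 1 ≤ mittagLeffler α z := by
  have h := (summable_pow_div_Gamma (q := 1) hα hz).le_tsum 0 fun k _ =>
    div_nonneg (by positivity) (Real.Gamma_pos_of_pos (by positivity)).le
  simpa [mittagLeffler] using h

lemma ofReal_mittagLeffler {α z : ℝ} (hα : 0 < α) (hz : 0 ≤ z) :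
    ENNReal.ofReal (mittagLeffler α z)
      = ∑' k : ℕ, ENNReal.ofReal (z ^ k / Real.Gamma (α * k + 1)) :=
  ENNReal.ofReal_tsum_of_nonneg
    (fun _ => div_nonneg (by positivity) (Real.Gamma_pos_of_pos (by positivity)).le)
    (summable_pow_div_Gamma hα hz)

/-- Ψ-fractional Gronwall inequality with nondecreasing `v`:
    Mittag-Leffler bound. -/
theorem psi_fractional_gronwall_mittagLeffler
    (α a T : ℝ) (hα : 0 < α) (haT : a < T)
    (Ψ Ψ' u v g : ℝ → ℝ)
    (hΨderiv : ∀ t ∈ Set.Icc a T, HasDerivAt Ψ (Ψ' t) t)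
    (hΨ'cont : ContinuousOn Ψ' (Set.Icc a T))
    (hΨ'pos : ∀ t ∈ Set.Icc a T, 0 < Ψ' t)
    (hΨmono : StrictMonoOn Ψ (Set.Icc a T))
    (hu_int : IntegrableOn u (Set.Icc a T))
    (hv_int : IntegrableOn v (Set.Icc a T))
    (hu_nonneg : ∀ t ∈ Set.Icc a T, 0 ≤ u t)
    (hv_nonneg : ∀ t ∈ Set.Icc a T, 0 ≤ v t)
    (hv_mono : MonotoneOn v (Set.Icc a T))
    (hg_cont : ContinuousOn g (Set.Icc a T))
    (hg_nonneg : ∀ t ∈ Set.Icc a T, 0 ≤ g t)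
    (hg_mono : MonotoneOn g (Set.Icc a T))
    (hineq : ∀ t ∈ Set.Icc a T,
      u t ≤ v t + g t * ∫ s in a..t, Ψ' s * (Ψ t - Ψ s) ^ (α - 1) * u s) :
    ∀ t ∈ Set.Icc a T,
      u t ≤ v t * mittagLeffler α (g t * Real.Gamma α * (Ψ t - Ψ a) ^ α) := by
  intro t ht
  have hz : 0 ≤ g t * Real.Gamma α * (Ψ t - Ψ a) ^ α := by
    have h1 := hg_nonneg t ht
    have h2 := Real.Gamma_pos_of_pos hα
    have h3 : 0 ≤ Ψ t - Ψ a :=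
      sub_nonneg.2 (hΨmono.monotoneOn (left_mem_Icc.2 haT.le) ht ht.1)
    positivity
  have hE := one_le_mittagLeffler hα hz
  rcases ht.1.eq_or_lt with rfl | hat
  · have h := hineq a ht
    rw [intervalIntegral.integral_same, mul_zero, add_zero] at h
    exact h.trans (le_mul_of_one_le_right (hv_nonneg a ht) hE)
  have hsub : Icc a t ⊆ Icc a T := Icc_subset_Icc_right ht.2
  have hderiv : ∀ s ∈ Icc a t, HasDerivAt Ψ (Ψ' s) s := fun s hs => hΨderiv s (hsub hs)
  have hcont := hΨ'cont.mono hsub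
  have hpos : ∀ s ∈ Icc a t, 0 < Ψ' s := fun s hs => hΨ'pos s (hsub hs)
  have hmono := hΨmono.mono hsub
  have hΓ := Real.Gamma_pos_of_pos hα
  set c := g t * Real.Gamma α with hc_def
  have hc : 0 ≤ c := mul_nonneg (hg_nonneg t ht) hΓ.le
  let f : ℝ → ℝ≥0∞ := fun s => ENNReal.ofReal (u s)
  have hu : IntegrableOn u (Ioo a t) := hu_int.mono_set (Ioo_subset_Icc_self.trans hsub)
  have hle : ∀ s ∈ Ioc a t,
      f s ≤ ENNReal.ofReal (v t) + ENNReal.ofReal c * psiIntegral Ψ Ψ' a α f s := by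
    intro s hs
    have hs' : s ∈ Icc a T := hsub (Ioc_subset_Icc_self hs)
    have hintegral : ENNReal.ofReal (∫ r in a..s, Ψ' r * (Ψ s - Ψ r) ^ (α - 1) * u r)
        ≤ ENNReal.ofReal (Real.Gamma α) * psiIntegral Ψ Ψ' a α f s := by
      rw [intervalIntegral.integral_of_le hs.1.le, integral_Ioc_eq_integral_Ioo, psiIntegral,
        ← lintegral_const_mul' _ _ ofReal_ne_top]
      refine (Real.ofReal_le_enorm _).trans ((enorm_integral_le_lintegral_enorm _).trans
        (setLIntegral_mono' measurableSet_Ioo fun r hr => ?_))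
      have hr' : r ∈ Icc a T := ⟨hr.1.le, hr.2.le.trans hs'.2⟩
      have h1 : 0 < Ψ s - Ψ r := sub_pos.2 (hΨmono hr' hs' hr.2)
      have h2 := hΨ'pos r hr'
      have h3 := hu_nonneg r hr'
      rw [Real.enorm_of_nonneg (by positivity), psiKernel, ← mul_assoc, ← ofReal_mul hΓ.le,
        ← ofReal_mul (by positivity)]
      apply le_of_eq
      congr 1
      field_simp
    calc f s ≤ ENNReal.ofReal
          (v s + g s * ∫ r in a..s, Ψ' r * (Ψ s - Ψ r) ^ (α - 1) * u r) :=
        ofReal_le_ofReal (hineq s hs')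
      _ ≤ ENNReal.ofReal (v s) + ENNReal.ofReal (g s) *
          ENNReal.ofReal (∫ r in a..s, Ψ' r * (Ψ s - Ψ r) ^ (α - 1) * u r) := by
        rw [← ofReal_mul (hg_nonneg s hs')]
        exact ofReal_add_le
      _ ≤ ENNReal.ofReal (v t) + ENNReal.ofReal (g t) *
          (ENNReal.ofReal (Real.Gamma α) * psiIntegral Ψ Ψ' a α f s) := by
        have := hv_mono hs' ht hs.2
        have := hg_mono hs' ht hs.2
        gcongr
      _ = _ := by rw [hc_def, ofReal_mul (hg_nonneg t ht), mul_assoc]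
  have hfin : ∫⁻ s in Ioo a t, f s ≠ ∞ := hu.lintegral_lt_top.ne
  have hlim := (tendsto_pow_mul_psiIntegral hat hcont hpos hmono hα hfin hc).comp
    (tendsto_add_atTop_nat 1)
  have hbound : ∀ n : ℕ, f t ≤
      ENNReal.ofReal (v t) * ENNReal.ofReal (mittagLeffler α (c * (Ψ t - Ψ a) ^ α))
        + ENNReal.ofReal c ^ (n + 1) * psiIntegral Ψ Ψ' a (α * (n + 1 : ℕ)) f t := by
    intro n
    refine (psiIntegral_iterate_bound hat hderiv hcont hpos hmono hα
      hu.aestronglyMeasurable.aemeasurable.ennreal_ofReal ofReal_ne_top hc hle n).trans ?_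
    rw [ofReal_mittagLeffler hα hz]
    gcongr
    exact ENNReal.sum_le_tsum _
  have hmain := ge_of_tendsto' (hlim.const_add _) hbound
  rw [add_zero, ← ofReal_mul (hv_nonneg t ht)] at hmain
  exact (ofReal_le_ofReal_iff (mul_nonneg (hv_nonneg t ht) (zero_le_one.trans hE))).1 hmain
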